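/- arXiv:2311.17706 — 2 statements merged into one kernel-verified Lean document; each statement's English description precedes it below -/
import Mathlib

section
/- Let p be an odd prime, n ≥ 1, and A = (a_{ij}) a symmetric n×n integer matrix with gcd(det A, p) = 1; write Q(y) = y^t A y and Q'(L) = L^t adj(A)^t L. Let m, r be integers with 0 ≤ r ≤ m − 2 and let L = (l₁,...,lₙ)^t ∈ ℤ^n. Define E(l₁p^r,...,lₙp^r, lp^r; p^m) = Σ_{y₁,...,yₙ=1}^{p^m} e_{p^m}( l p^r Q(y) + p^r Σ_{i=1}^n lᵢ yᵢ ). If p^{m−r−1} does not divide Q'(L), then Σ_{l=1, p∤l}^{p^{m−r}} E(l₁p^r,...,lₙp^r, lp^r; p^m) = 0. -/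
/-- The additive character `e_q(a) = e^{2πia/q}`, defined on residues modulo `q`. -/
noncomputable def eChar (q : ℕ) (a : ZMod q) : ℂ :=
  Complex.exp (2 * Real.pi * Complex.I * (a.val : ℂ) / (q : ℂ))

/-- The exponential sum
`E(l₁p^r, …, lₙp^r, lp^r; p^m) = Σ_{y₁,…,yₙ=1}^{p^m} e_{p^m}(lp^r Q(y) + p^r Σ lᵢyᵢ)`,
where `Q(y) = yᵗAy`. -/
noncomputable def Esum (p : ℕ) [NeZero p] (m r : ℕ) {n : ℕ}
    (A : Matrix (Fin n) (Fin n) ℤ) (L : Fin n → ℤ) (l : ℤ) : ℂ :=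
  ∑ y : Fin n → ZMod (p ^ m),
    eChar (p ^ m)
      (((l * (p : ℤ) ^ r * (∑ i, ∑ j, A i j * ((y i).val : ℤ) * ((y j).val : ℤ))
          + (p : ℤ) ^ r * ∑ i, L i * ((y i).val : ℤ) : ℤ) : ZMod (p ^ m)))

open Matrix in
/-- Completing the square: `l Q(y) + L ⬝ y = l Q(y + (2l)⁻¹ A⁻¹ L) - (4l)⁻¹ Lᵗ A⁻¹ L`, with `h`
the inverse of `2`, `l'` the inverse of `l` and `D` the inverse of `det A`. -/
theorem complete_square {R : Type*} [CommRing R] {n : ℕ} (A : Matrix (Fin n) (Fin n) R)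
    (hA : A.IsSymm) (L y : Fin n → R) {h l l' D : R} (hh : 2 * h = 1) (hl : l * l' = 1)
    (hD : A.det * D = 1) :
    l * (y ⬝ᵥ A *ᵥ y) + L ⬝ᵥ y =
      l * ((y + (h * l' * D) • (A.adjugate *ᵥ L)) ⬝ᵥ
          A *ᵥ (y + (h * l' * D) • (A.adjugate *ᵥ L)))
        + -(h ^ 2 * l' * D * (L ⬝ᵥ A.adjugate *ᵥ L)) := by
  set z := A.adjugate *ᵥ L with hz
  have hAz : A *ᵥ z = A.det • L := by
    rw [hz, mulVec_mulVec, mul_adjugate, smul_mulVec, one_mulVec]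
  have hzA : z ⬝ᵥ A *ᵥ y = A.det * (L ⬝ᵥ y) := by
    rw [dotProduct_mulVec, ← mulVec_transpose, hA.eq, hAz, smul_dotProduct, smul_eq_mul]
  simp only [mulVec_add, mulVec_smul, add_dotProduct, dotProduct_add, smul_dotProduct,
    dotProduct_smul, hAz, hzA, smul_eq_mul, dotProduct_comm y L, dotProduct_comm z L]
  linear_combination (-(L ⬝ᵥ y)) * hh - (2 * h) * (L ⬝ᵥ y) * hl
    - (2 * h) * (l * l') * (L ⬝ᵥ y) * hD
    - h ^ 2 * l' * D * (L ⬝ᵥ z) * hl - h ^ 2 * l' * D * (l * l') * (L ⬝ᵥ z) * hD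

open Matrix in
/-- The twisted sum of quadratic Gauss sums over the units of a finite ring vanishes as soon as
the dual form takes at `L` a value that is not annihilated by some nilpotent `d` while it is
annihilated by `d ^ 2`. -/
theorem sum_units_sum_quadratic_eq_zero {R : Type*} [CommRing R] [Fintype R] [DecidableEq R]
    {ψ : AddChar R ℂ} (hψ : ψ.IsPrimitive) {n : ℕ} (A : Matrix (Fin n) (Fin n) R)
    (hA : A.IsSymm) (hdet : IsUnit A.det) (h2 : IsUnit (2 : R)) (L : Fin n → R) {d : R}
    (hd : IsNilpotent d) (hne : (L ⬝ᵥ A.adjugate *ᵥ L) * d ≠ 0)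
    (hsq : (L ⬝ᵥ A.adjugate *ᵥ L) * d ^ 2 = 0) :
    ∑ l : Rˣ, ∑ y : Fin n → R, ψ ((l : R) * (y ⬝ᵥ A *ᵥ y) + L ⬝ᵥ y) = 0 := by
  obtain ⟨h, hh⟩ := h2.exists_right_inv
  obtain ⟨D, hD⟩ := hdet.exists_right_inv
  set q := L ⬝ᵥ A.adjugate *ᵥ L
  let G : R → ℂ := fun l ↦ ∑ y : Fin n → R, ψ (l * (y ⬝ᵥ A *ᵥ y))
  have key (l : Rˣ) : ∑ y : Fin n → R, ψ ((l : R) * (y ⬝ᵥ A *ᵥ y) + L ⬝ᵥ y) =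
      G l * ψ (-(h ^ 2 * (l⁻¹ : Rˣ) * D * q)) := by
    simp_rw [complete_square A hA L _ hh l.mul_inv hD, AddChar.map_add_eq_mul, ← Finset.sum_mul]
    congr 1
    exact Equiv.sum_comp (Equiv.addRight _) fun y : Fin n → R ↦ ψ (l * (y ⬝ᵥ A *ᵥ y))
  have hG (l : R) (w : Rˣ) : G (l * (w : R) ^ 2) = G l := by
    refine Eq.trans ?_ (Equiv.sum_comp (MulAction.toPerm w) fun y : Fin n → R ↦ ψ (l * (y ⬝ᵥ A *ᵥ y)))
    refine Finset.sum_congr rfl fun y _ ↦ ?_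
    simp only [MulAction.toPerm_apply, Units.smul_def, mulVec_smul, dotProduct_smul,
      smul_dotProduct, smul_eq_mul]
    ring_nf
  have shift (t : R) : ∑ l : Rˣ, G l * ψ (-(h ^ 2 * (l⁻¹ : Rˣ) * D * q)) =
      ∑ l : Rˣ, G l * ψ (-(h ^ 2 * (l⁻¹ : Rˣ) * D * q)) *
        ψ (t * -(h * (l⁻¹ : Rˣ) * D * (q * d))) := by
    obtain ⟨w, hw⟩ : IsUnit (1 + d * t) :=
      ((Commute.all d t).isNilpotent_mul_right hd).isUnit_one_add
    rw [← Equiv.sum_comp (Equiv.mulRight (w⁻¹ ^ 2))]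
    refine Finset.sum_congr rfl fun l _ ↦ ?_
    rw [mul_assoc (G l), ← AddChar.map_add_eq_mul]
    congr 1
    · simpa using hG l w⁻¹
    · congr 1
      simp only [Equiv.coe_mulRight, mul_inv, inv_pow, inv_inv, Units.val_mul,
        Units.val_pow_eq_pow_val, hw]
      linear_combination (-h ^ 2 * (l⁻¹ : Rˣ) * D * t ^ 2) * hsq
        - h * (l⁻¹ : Rˣ) * D * q * d * t * hh
  have hcard : (Fintype.card R : ℂ) ≠ 0 := Nat.cast_ne_zero.mpr Fintype.card_ne_zero
  simp_rw [key]
  refine (mul_eq_zero.mp ?_).resolve_left hcard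
  rw [← nsmul_eq_mul, ← Finset.card_univ, ← Finset.sum_const,
    Finset.sum_congr rfl fun t _ ↦ shift t, Finset.sum_comm]
  refine Finset.sum_eq_zero fun l _ ↦ ?_
  rw [← Finset.mul_sum, AddChar.sum_mulShift _ hψ, if_neg, Nat.cast_zero, mul_zero]
  intro h0
  apply hne
  linear_combination (-2 * l * A.det) * h0 - q * d * hD - q * d * A.det * D * l.mul_inv
    - q * d * A.det * D * l * (l⁻¹ : Rˣ) * hh

/-- Summing over a surjective image of a finite group repeats each value equally often. -/
theorem sum_comp_addMonoidHom_of_surjective {G H : Type*} [AddGroup G] [AddGroup H] [Fintype G]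
    [Fintype H] [DecidableEq H] (φ : G →+ H) (hφ : Function.Surjective φ) (f : H → ℂ) :
    ∑ x, f (φ x) = (Finset.univ.filter fun x ↦ φ x = 0).card * ∑ y, f y := by
  rw [← Finset.sum_fiberwise Finset.univ φ, Finset.mul_sum]
  refine Finset.sum_congr rfl fun y _ ↦ ?_
  rw [Finset.sum_congr rfl fun x hx ↦ by rw [(Finset.mem_filter.mp hx).2], Finset.sum_const,
    nsmul_eq_mul, AddMonoidHom.card_fiber_eq_of_mem_range φ (hφ y) (hφ 0)]

theorem eChar_pow_mul_intCast (p : ℕ) [NeZero p] {m r : ℕ} (hr : r ≤ m) (x : ℤ) :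
    eChar (p ^ m) (((p : ℤ) ^ r * x : ℤ) : ZMod (p ^ m)) =
      ZMod.stdAddChar (N := p ^ (m - r)) (x : ZMod (p ^ (m - r))) := by
  have hstd : eChar (p ^ m) (((p : ℤ) ^ r * x : ℤ) : ZMod (p ^ m)) =
      ZMod.stdAddChar (N := p ^ m) (((p : ℤ) ^ r * x : ℤ) : ZMod (p ^ m)) := by
    rw [ZMod.stdAddChar_apply, ZMod.toCircle_apply, eChar]
  have hp : (p : ℂ) ≠ 0 := Nat.cast_ne_zero.mpr (NeZero.ne p)
  obtain ⟨k, rfl⟩ := Nat.exists_eq_add_of_le hr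
  rw [hstd, ZMod.stdAddChar_coe, ZMod.stdAddChar_coe, Nat.add_sub_cancel_left]
  congr 1
  push_cast
  field_simp
  ring

open Matrix in
theorem Esum_eq (p : ℕ) [NeZero p] {m r : ℕ} (hr : r ≤ m) {n : ℕ}
    (A : Matrix (Fin n) (Fin n) ℤ) (L : Fin n → ℤ) :
    ∃ N : ℕ, ∀ l : ZMod (p ^ (m - r)), Esum p m r A L (l.val : ℤ) =
      N * ∑ y : Fin n → ZMod (p ^ (m - r)), ZMod.stdAddChar
        (l * (y ⬝ᵥ A.map (Int.castRingHom _) *ᵥ y) + (fun i ↦ (L i : ZMod _)) ⬝ᵥ y) := by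
  have hdvd : p ^ (m - r) ∣ p ^ m := pow_dvd_pow p (m.sub_le r)
  let φ : (Fin n → ZMod (p ^ m)) →+ (Fin n → ZMod (p ^ (m - r))) :=
    (ZMod.castHom hdvd (ZMod (p ^ (m - r)))).toAddMonoidHom.compLeft (Fin n)
  have hφ : Function.Surjective φ := (ZMod.castHom_surjective hdvd).comp_left
  refine ⟨_, fun l ↦ Eq.trans ?_ (sum_comp_addMonoidHom_of_surjective φ hφ _)⟩
  refine Finset.sum_congr rfl fun y _ ↦ ?_
  rw [mul_comm (l.val : ℤ), mul_assoc, ← mul_add, eChar_pow_mul_intCast p hr]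
  congr 1
  simp [φ, dotProduct, mulVec, Finset.mul_sum, ZMod.natCast_val, mul_assoc, mul_comm,
    mul_left_comm]

theorem sum_ite_isUnit {R : Type*} [Monoid R] [Fintype R] [Fintype Rˣ] (f : R → ℂ)
    [DecidablePred (IsUnit : R → Prop)] :
    ∑ x, (if IsUnit x then f x else 0) = ∑ u : Rˣ, f u := by
  rw [← Finset.sum_filter]
  refine (Finset.sum_bij (fun (u : Rˣ) _ ↦ (u : R)) ?_ ?_ ?_ ?_).symm
  · simp
  · exact fun _ _ _ _ ↦ Units.ext
  · intro x hx
    obtain ⟨u, rfl⟩ := (Finset.mem_filter.mp hx).2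
    exact ⟨u, Finset.mem_univ u, rfl⟩
  · simp

/-- An integer not divisible by `p ^ k` has a nonzero multiple `q p ^ j` modulo `p ^ (k + 1)` with
`0 < j` and `q p ^ (2 j) = 0`. -/
theorem exists_nilpotent_multiplier {p k : ℕ} (hp : p.Prime) {q : ℤ} (hq : ¬ (p : ℤ) ^ k ∣ q) :
    ∃ d : ZMod (p ^ (k + 1)), IsNilpotent d ∧ (q : ZMod (p ^ (k + 1))) * d ≠ 0 ∧
      (q : ZMod (p ^ (k + 1))) * d ^ 2 = 0 := by
  have hpz : Prime (p : ℤ) := Nat.prime_iff_prime_int.mp hp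
  have hfin : FiniteMultiplicity (p : ℤ) q :=
    ⟨k, fun hdvd ↦ hq ((pow_dvd_pow _ k.le_succ).trans hdvd)⟩
  obtain ⟨c, hc, hpc⟩ := hfin.exists_eq_pow_mul_and_not_dvd
  set a := multiplicity (p : ℤ) q
  have hak : a < k := by
    by_contra! hka
    exact hq (hc ▸ (pow_dvd_pow _ hka).mul_right c)
  obtain ⟨j, rfl⟩ := Nat.exists_eq_add_of_lt hak
  refine ⟨(((p : ℤ) ^ (j + 1) : ℤ) : ZMod _), ⟨a + j + 1 + 1, ?_⟩, ?_, ?_⟩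
  · rw [← Int.cast_pow, ZMod.intCast_zmod_eq_zero_iff_dvd, ← pow_mul]
    push_cast
    exact pow_dvd_pow _ (Nat.le_mul_of_pos_left _ j.succ_pos)
  · rw [← Int.cast_mul, Ne, ZMod.intCast_zmod_eq_zero_iff_dvd, hc]
    push_cast
    intro hdvd
    have heq : (p : ℤ) ^ a * c * (p : ℤ) ^ (j + 1) = (p : ℤ) ^ (a + j + 1) * c := by ring
    rw [heq, pow_succ] at hdvd
    exact hpc (Int.dvd_of_mul_dvd_mul_left (pow_ne_zero _ hpz.ne_zero) hdvd)
  · rw [← Int.cast_pow, ← Int.cast_mul, ZMod.intCast_zmod_eq_zero_iff_dvd, hc]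
    push_cast
    exact ⟨c * (p : ℤ) ^ j, by ring⟩

theorem ZMod.isUnit_intCast_pow_of_isCoprime {p : ℕ} (k : ℕ) {a : ℤ} (h : IsCoprime a (p : ℤ)) :
    IsUnit (a : ZMod (p ^ k)) := by
  obtain ⟨u, v, huv⟩ := h.pow_right (n := k)
  refine IsUnit.of_mul_eq_one (u : ZMod (p ^ k)) ?_
  have hcast := congrArg (Int.cast : ℤ → ZMod (p ^ k)) huv
  have hzero : (p : ZMod (p ^ k)) ^ k = 0 := by exact_mod_cast ZMod.natCast_self (p ^ k)
  push_cast at hcast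
  rw [hzero, mul_zero, add_zero] at hcast
  rw [mul_comm, hcast]

/-- For an odd prime `p`, `A` symmetric with `gcd(det A, p) = 1`, `0 ≤ r ≤ m - 2`:
if `p^{m-r-1}` does not divide `Q'(L) = Lᵗ adj(A)ᵗ L`, then
`Σ_{l=1, p∤l}^{p^{m-r}} E(l₁p^r, …, lₙp^r, lp^r; p^m) = 0`. -/
theorem stmt13 (p : ℕ) [NeZero p] (hp : p.Prime) (hodd : p ≠ 2)
    (n : ℕ) (hn : 1 ≤ n)
    (A : Matrix (Fin n) (Fin n) ℤ) (hA : A.IsSymm) (hdet : Int.gcd A.det (p : ℤ) = 1)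
    (m r : ℕ) (hr : r + 2 ≤ m)
    (L : Fin n → ℤ)
    (hQ' : ¬ (p : ℤ) ^ (m - r - 1) ∣ (∑ i, ∑ j, A.adjugate j i * L i * L j)) :
    (∑ l : ZMod (p ^ (m - r)),
        if ¬ (p : ℤ) ∣ (l.val : ℤ) then Esum p m r A L (l.val : ℤ) else 0) = 0 := by
  obtain ⟨N, hN⟩ := Esum_eq p (by omega : r ≤ m) A L
  have hiff (l : ZMod (p ^ (m - r))) : ¬ (p : ℤ) ∣ (l.val : ℤ) ↔ IsUnit l := by
    rw [Int.natCast_dvd_natCast, ← hp.coprime_iff_not_dvd, Nat.coprime_comm,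
      ← Nat.coprime_pow_right_iff (n := m - r) (by omega), ← ZMod.isUnit_iff_coprime,
      ZMod.natCast_val, ZMod.cast_id]
  classical
  simp_rw [hiff, hN]
  rw [sum_ite_isUnit fun l : ZMod (p ^ (m - r)) ↦ _, ← Finset.mul_sum]
  have hdual : ((∑ i, ∑ j, A.adjugate j i * L i * L j : ℤ) : ZMod (p ^ (m - r))) =
      (fun i ↦ (L i : ZMod (p ^ (m - r)))) ⬝ᵥ
        (A.map (Int.castRingHom _)).adjugate.mulVec fun i ↦ (L i : ZMod (p ^ (m - r))) := by
    have hmap : (A.map (Int.castRingHom (ZMod (p ^ (m - r))))).adjugate =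
        A.adjugate.map (Int.castRingHom _) :=
      (RingHom.map_adjugate (Int.castRingHom (ZMod (p ^ (m - r)))) A).symm
    rw [hmap, Finset.sum_comm]
    simp [dotProduct, Matrix.mulVec, Finset.mul_sum, mul_comm]
  have hunit : IsUnit (A.map (Int.castRingHom (ZMod (p ^ (m - r))))).det := by
    have hmap : (A.map (Int.castRingHom (ZMod (p ^ (m - r))))).det = (A.det : ZMod _) :=
      (RingHom.map_det (Int.castRingHom (ZMod (p ^ (m - r)))) A).symm
    rw [hmap]
    exact ZMod.isUnit_intCast_pow_of_isCoprime _ (Int.isCoprime_iff_gcd_eq_one.mpr hdet)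
  have htwo : IsUnit (2 : ZMod (p ^ (m - r))) := by
    have hcop : IsCoprime (2 : ℤ) (p : ℤ) := by
      exact_mod_cast Nat.isCoprime_iff_coprime.mpr
        ((Nat.coprime_primes Nat.prime_two hp).mpr hodd.symm)
    exact_mod_cast ZMod.isUnit_intCast_pow_of_isCoprime (m - r) hcop
  obtain ⟨d, hd, hne, hsq⟩ : ∃ d : ZMod (p ^ (m - r)), IsNilpotent d ∧
      ((∑ i, ∑ j, A.adjugate j i * L i * L j : ℤ) : ZMod (p ^ (m - r))) * d ≠ 0 ∧
      ((∑ i, ∑ j, A.adjugate j i * L i * L j : ℤ) : ZMod (p ^ (m - r))) * d ^ 2 = 0 := by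
    have hexists := exists_nilpotent_multiplier hp hQ'
    rwa [show m - r - 1 + 1 = m - r by omega] at hexists
  rw [hdual] at hne hsq
  rw [sum_units_sum_quadratic_eq_zero (ZMod.isPrimitive_stdAddChar _) _ (hA.map _) hunit htwo _
    hd hne hsq, mul_zero]
end

section
/- Let p be an odd prime, n ≥ 1, m ≥ 2, and A = (a_{ij}) a symmetric n×n integer matrix with gcd(det A, p) = 1; write Q(y) = y^t A y. Let k₁,...,kₙ ∈ ℤ with gcd(k₁,...,kₙ, p^m) = p^r for some 0 ≤ r ≤ m − 2, and let h ∈ ℤ with ord_p(h) ≠ r (i.e. the exact power of p dividing h, capped at m, is not p^r). Then Σ_{y₁,...,yₙ=1, (y₁,...,yₙ) ≢ (0,...,0) mod p}^{p^m} e_{p^m}( h Q(y) + Σ_{i=1}^n kᵢ yᵢ ) = 0. -/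
open Matrix in
/-- A sum of an additive character of a quadratic polynomial over a set stable under translation
by `t • z` vanishes when `t` times the gradient does not vanish on that set and the second-order
term is killed. -/
theorem sum_addChar_quadratic_eq_zero {R ι : Type*} [CommRing R] [Fintype R]
    [Fintype ι] [DecidableEq ι] {ψ : AddChar R ℂ} (hψ : ψ.IsPrimitive) {B : Matrix ι ι R}
    (hB : B.IsSymm) (κ : ι → R) (η t : R) (P : (ι → R) → Prop) [DecidablePred P]
    (hP : ∀ y z, P (y + t • z) ↔ P y) (ht : η * t * t = 0)
    (hgrad : ∀ y, P y → t • ((2 * η) • (B *ᵥ y) + κ) ≠ 0) :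
    ∑ y : ι → R, (if P y then ψ (η * (y ⬝ᵥ B *ᵥ y) + κ ⬝ᵥ y) else 0) = 0 := by
  set F : (ι → R) → ℂ := fun y => if P y then ψ (η * (y ⬝ᵥ B *ᵥ y) + κ ⬝ᵥ y) else 0 with hF
  have hchar : ∀ c : ι → R, c ≠ 0 → ∑ z : ι → R, ψ (c ⬝ᵥ z) = 0 := by
    intro c hc
    obtain ⟨i, hi⟩ := Function.ne_iff.mp hc
    obtain ⟨a, ha⟩ := AddChar.ne_one_iff.mp (hψ hi)
    let φ : AddChar (ι → R) ℂ :=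
      { toFun := fun z => ψ (c ⬝ᵥ z)
        map_zero_eq_one' := by simp
        map_add_eq_mul' := fun z w => by rw [dotProduct_add, AddChar.map_add_eq_mul] }
    refine AddChar.sum_eq_zero_of_ne_one (ψ := φ) (AddChar.ne_one_iff.mpr ⟨Pi.single i a, ?_⟩)
    simpa [φ] using ha
  have hinner : ∀ y, ∑ z : ι → R, F (y + t • z) = 0 := by
    intro y
    by_cases hy : P y
    · have hexp : ∀ z, F (y + t • z) =
          ψ (η * (y ⬝ᵥ B *ᵥ y) + κ ⬝ᵥ y) * ψ ((t • ((2 * η) • (B *ᵥ y) + κ)) ⬝ᵥ z) := by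
        intro z
        have hsymm : y ⬝ᵥ B *ᵥ z = (B *ᵥ y) ⬝ᵥ z := by
          rw [dotProduct_mulVec, ← mulVec_transpose, hB.eq]
        simp only [hF, hP, hy, if_true]
        rw [← AddChar.map_add_eq_mul]
        congr 1
        simp only [mulVec_add, mulVec_smul, dotProduct_add, add_dotProduct, smul_dotProduct,
          dotProduct_smul, smul_eq_mul, hsymm, dotProduct_comm z (B *ᵥ y)]
        linear_combination (z ⬝ᵥ B *ᵥ z) * ht
      simp_rw [hexp, ← Finset.mul_sum, hchar _ (hgrad y hy), mul_zero]
    · simp [hF, hP, hy]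
  have hshift : ∀ z : ι → R, ∑ y, F (y + t • z) = ∑ y, F y := fun z =>
    Equiv.sum_comp (Equiv.addRight (t • z)) F
  have hcard : (Fintype.card (ι → R) : ℂ) * ∑ y, F y = 0 := by
    rw [← nsmul_eq_mul, ← Finset.card_univ, ← Finset.sum_const,
      ← Finset.sum_congr rfl fun z _ => hshift z, Finset.sum_comm]
    exact Finset.sum_eq_zero fun y _ => hinner y
  exact (mul_eq_zero.mp hcard).resolve_left (Nat.cast_ne_zero.mpr Fintype.card_ne_zero)

theorem eChar_eq_stdAddChar (q : ℕ) [NeZero q] (a : ZMod q) :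
    eChar q a = ZMod.stdAddChar a := by
  rw [ZMod.stdAddChar_apply, ZMod.toCircle_apply, eChar]

open Matrix in
/-- An integer vector killed modulo a prime by a matrix invertible modulo that prime vanishes
modulo the prime. -/
theorem prime_dvd_of_dvd_mulVec {ι : Type*} [Fintype ι] [DecidableEq ι] {p : ℤ} (hp : Prime p)
    {A : Matrix ι ι ℤ} (hdet : ¬ p ∣ A.det) {y : ι → ℤ} (hy : ∀ i, p ∣ (A *ᵥ y) i) (i : ι) :
    p ∣ y i := by
  have hadj : (A.adjugate *ᵥ (A *ᵥ y)) i = A.det * y i := by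
    rw [mulVec_mulVec, adjugate_mul, smul_mulVec, one_mulVec, Pi.smul_apply, smul_eq_mul]
  refine (hp.dvd_or_dvd ?_).resolve_left hdet
  rw [← hadj]
  exact Finset.dvd_sum fun j _ => (hy j).mul_left _

open Matrix in
/-- If `p ^ r` is the exact power of `p` dividing `k` and not the exact power dividing `h`, then
some multiple `p ^ e` of the gradient of `h Q(y) + k ⬝ y` is nonzero modulo `p ^ m` for every
`y` nonzero modulo `p`. -/
theorem exists_pow_mul_gradient_not_dvd {ι : Type*} [Fintype ι] [DecidableEq ι] {p : ℤ}
    (hp : Prime p) (h2 : ¬ p ∣ 2) {A : Matrix ι ι ℤ} (hdet : ¬ p ∣ A.det) {k : ι → ℤ} {r m : ℕ}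
    (hr : r + 2 ≤ m) (hk : ∀ i, p ^ r ∣ k i) (hk' : ∃ i, ¬ p ^ (r + 1) ∣ k i) {h : ℤ}
    (hh : ¬ (p ^ r ∣ h ∧ ¬ p ^ (r + 1) ∣ h)) :
    ∃ e, e ≠ 0 ∧ p ^ m ∣ h * p ^ e * p ^ e ∧
      ∀ y : ι → ℤ, (¬ ∀ i, p ∣ y i) → ∃ i, ¬ p ^ m ∣ p ^ e * (2 * h * (A *ᵥ y) i + k i) := by
  by_cases hrh : p ^ r ∣ h
  · have hrh' : p ^ (r + 1) ∣ h := by tauto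
    obtain ⟨d, rfl⟩ := Nat.exists_eq_add_of_le hr
    obtain ⟨i, hi⟩ := hk'
    obtain ⟨g, rfl⟩ := hrh'
    refine ⟨d + 1, by omega, ⟨g * p ^ (d + 1), by ring⟩, fun y _ => ⟨i, fun hdvd => hi ?_⟩⟩
    rw [show r + 2 + d = (d + 1) + (r + 1) by ring, pow_add p (d + 1),
      mul_dvd_mul_iff_left (pow_ne_zero _ hp.ne_zero)] at hdvd
    exact (dvd_add_right ⟨2 * g * (A *ᵥ y) i, by ring⟩).mp hdvd
  · have hh0 : h ≠ 0 := fun h0 => hrh (h0 ▸ dvd_zero _)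
    obtain ⟨g, hgh, hg⟩ := (FiniteMultiplicity.of_prime_left hp hh0).exists_eq_pow_mul_and_not_dvd
    generalize multiplicity p h = s at hgh
    subst hgh
    have hsr : s < r := by
      by_contra! hle
      exact hrh ((pow_dvd_pow p hle).mul_right g)
    obtain ⟨d, rfl⟩ := Nat.exists_eq_add_of_le (show s + 2 ≤ m by omega)
    refine ⟨d + 1, by omega, ⟨g * p ^ d, by ring⟩, fun y hy => ?_⟩
    by_contra! hall
    refine hy (prime_dvd_of_dvd_mulVec hp hdet fun i => ?_)
    have hdvd := hall i
    rw [show s + 2 + d = (d + 1) + (s + 1) by ring, pow_add p (d + 1),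
      mul_dvd_mul_iff_left (pow_ne_zero _ hp.ne_zero)] at hdvd
    have hquad := (dvd_add_left ((pow_dvd_pow p hsr).trans (hk i))).mp hdvd
    rw [show 2 * (p ^ s * g) * (A *ᵥ y) i = p ^ s * (2 * g * (A *ᵥ y) i) by ring, pow_succ,
      mul_dvd_mul_iff_left (pow_ne_zero _ hp.ne_zero)] at hquad
    exact (hp.dvd_or_dvd hquad).resolve_left fun h2g => (hp.dvd_or_dvd h2g).elim h2 hg

/-- For an odd prime `p`, `m ≥ 2`, `A` symmetric with `gcd(det A, p) = 1`,
`k₁,…,kₙ ∈ ℤ` with `gcd(k₁,…,kₙ,p^m) = p^r` for some `0 ≤ r ≤ m - 2`, and `h ∈ ℤ`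
whose `p`-adic valuation (capped at `m`) is not `r` (equivalently, since `r < m`, it is
not the case that `p^r ∣ h` and `p^{r+1} ∤ h`), the sum
`Σ_{y mod p^m, y ≢ 0 mod p} e_{p^m}(h Q(y) + Σ kᵢyᵢ)` vanishes, where `Q(y) = yᵗAy`. -/
theorem stmt15 (p : ℕ) [NeZero p] (hp : p.Prime) (hodd : p ≠ 2)
    (n : ℕ) (hn : 1 ≤ n) (m : ℕ) (hm : 2 ≤ m)
    (A : Matrix (Fin n) (Fin n) ℤ) (hA : A.IsSymm) (hdet : Int.gcd A.det (p : ℤ) = 1)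
    (k : Fin n → ℤ) (r : ℕ) (hr : r + 2 ≤ m)
    (hgcd : gcd (Finset.univ.gcd k) ((p : ℤ) ^ m) = (p : ℤ) ^ r)
    (h : ℤ) (hh : ¬ ((p : ℤ) ^ r ∣ h ∧ ¬ (p : ℤ) ^ (r + 1) ∣ h)) :
    (∑ y : Fin n → ZMod (p ^ m),
        if ¬ ∀ i, (p : ℤ) ∣ ((y i).val : ℤ) then
          eChar (p ^ m)
            (((h * (∑ i, ∑ j, A i j * ((y i).val : ℤ) * ((y j).val : ℤ))
                + ∑ i, k i * ((y i).val : ℤ) : ℤ) : ZMod (p ^ m)))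
        else 0) = 0 := by
  have hpZ : Prime (p : ℤ) := Nat.prime_iff_prime_int.mp hp
  have h2 : ¬ (p : ℤ) ∣ 2 := fun hd =>
    hodd ((Nat.prime_dvd_prime_iff_eq hp Nat.prime_two).mp (by exact_mod_cast hd))
  have hdet' : ¬ (p : ℤ) ∣ A.det := fun hd =>
    hpZ.not_dvd_one (by simpa [hdet] using Int.dvd_coe_gcd hd dvd_rfl)
  have hk : ∀ i, (p : ℤ) ^ r ∣ k i := fun i =>
    (hgcd ▸ gcd_dvd_left _ _).trans (Finset.gcd_dvd (Finset.mem_univ i))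
  have hk' : ∃ i, ¬ (p : ℤ) ^ (r + 1) ∣ k i := by
    by_contra! hall
    have hdvd : (p : ℤ) ^ (r + 1) ∣ (p : ℤ) ^ r :=
      hgcd ▸ dvd_gcd (Finset.dvd_gcd fun i _ => hall i) (pow_dvd_pow _ (by omega))
    exact absurd ((pow_dvd_pow_iff hpZ.ne_zero hpZ.not_isUnit).mp hdvd) (by omega)
  obtain ⟨e, he, hsq, hgrad⟩ := exists_pow_mul_gradient_not_dvd hpZ h2 hdet' hr hk hk' hh
  have hcast : ∀ a : ℤ, (a : ZMod (p ^ m)) = 0 ↔ (p : ℤ) ^ m ∣ a := fun a => by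
    rw [ZMod.intCast_zmod_eq_zero_iff_dvd, Nat.cast_pow]
  have hval : ∀ a : ZMod (p ^ m), (((a.val : ℤ)) : ZMod (p ^ m)) = a := fun a => by simp
  have hpm : p ∣ p ^ m := dvd_pow_self p (by omega)
  have hred : ∀ a : ZMod (p ^ m), (p : ℤ) ∣ (a.val : ℤ) ↔ ZMod.castHom hpm (ZMod p) a = 0 :=
    fun a => by
      rw [← ZMod.intCast_zmod_eq_zero_iff_dvd, ← map_intCast (ZMod.castHom hpm (ZMod p)), hval]
  have hmain := sum_addChar_quadratic_eq_zero (ZMod.isPrimitive_stdAddChar (p ^ m))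
    (B := A.map (Int.cast : ℤ → ZMod (p ^ m))) (hA.map _) (fun i => (k i : ZMod (p ^ m)))
    (h : ZMod (p ^ m)) ((p : ZMod (p ^ m)) ^ e) (fun y => ¬ ∀ i, (p : ℤ) ∣ ((y i).val : ℤ))
    (fun y z => by
      simp only [hred, Pi.add_apply, Pi.smul_apply, smul_eq_mul, map_add, map_mul, map_pow,
        map_natCast, CharP.cast_eq_zero, zero_pow he, zero_mul, add_zero])
    (by exact_mod_cast (hcast (h * (p : ℤ) ^ e * (p : ℤ) ^ e)).mpr hsq)
    (fun y hy hzero => by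
      obtain ⟨i, hi⟩ := hgrad (fun i => ((y i).val : ℤ)) hy
      refine hi ((hcast _).mp ?_)
      simpa [Matrix.mulVec, dotProduct] using congrFun hzero i)
  rw [← hmain]
  refine Finset.sum_congr rfl fun y _ => ?_
  rw [eChar_eq_stdAddChar]
  congr 2
  simp [Matrix.mulVec, dotProduct, Finset.mul_sum, mul_assoc, mul_left_comm]
end
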